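/- arXiv:1712.09220 — 6 statements merged into one kernel-verified Lean document; each statement's English description precedes it below -/
import Mathlib

section
/- Let x ∈ ℝ and y ∈ ℝ \ {0} with x·y ≥ 0. Then for every z > 0, φ(y + x·z) − φ(y) − x·z·φ'(y) ≤ (2·|x·z|²/log δ)·1_{(0,ε]}(|y|)·min(1/|y|, δ/ε), where 1_{(0,ε]} denotes the indicator function of the interval (0,ε]. -/
open MeasureTheory Filter Set

/-- A second-order Taylor upper bound, from a one-sided bound on the second derivative. -/
lemma sub_sub_mul_le_mul_sq {f g k : ℝ → ℝ} {y h M : ℝ} (hf : ∀ t, y ≤ t → HasDerivAt f (g t) t)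
    (hg : ∀ t, y ≤ t → HasDerivAt g (k t) t) (hk : ∀ t, y ≤ t → k t ≤ M) (hM : 0 ≤ M)
    (hh : 0 ≤ h) : f (y + h) - f y - h * g y ≤ M * h ^ 2 := by
  rcases hh.eq_or_lt with rfl | hpos
  · simp
  obtain ⟨c, ⟨hyc, hc⟩, hfc⟩ := exists_hasDerivAt_eq_slope f g (by linarith : y < y + h)
    (fun t ht => (hf t ht.1).continuousAt.continuousWithinAt) (fun t ht => hf t ht.1.le)
  obtain ⟨d, ⟨hyd, -⟩, hgd⟩ := exists_hasDerivAt_eq_slope g k hyc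
    (fun t ht => (hg t ht.1).continuousAt.continuousWithinAt) (fun t ht => hg t ht.1.le)
  rw [add_sub_cancel_left, eq_div_iff hpos.ne'] at hfc
  rw [eq_div_iff (sub_pos.2 hyc).ne'] at hgd
  have h1 : g c - g y ≤ M * h := by
    rw [← hgd]
    exact mul_le_mul (hk d hyd.le) (by linarith) (by linarith) hM
  nlinarith [mul_le_mul_of_nonneg_right h1 hh]

/-- On `[y, ∞)`, a function supported in `[ε / δ, ε]` and bounded by `2 / (z log δ)` is bounded by
a constant which vanishes when `ε < y`. -/
lemma le_mul_indicator_mul_min {δ ε : ℝ} (hδ : 1 < δ) (hε : 0 < ε) {ψ : ℝ → ℝ}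
    (hψsupp : Function.support ψ ⊆ Set.Icc (ε / δ) ε)
    (hψbd : ∀ z > 0, ψ z ≤ 2 / (z * Real.log δ)) {y s : ℝ} (hy : 0 < y) (hs : y ≤ s) :
    ψ s ≤ 2 / Real.log δ * Set.indicator (Set.Ioc (0:ℝ) ε) (1 : ℝ → ℝ) y *
      min (1 / y) (δ / ε) := by
  have hlog : 0 < Real.log δ := Real.log_pos hδ
  have hδ0 : 0 < δ := by linarith
  by_cases h0 : ψ s = 0
  · rw [h0]
    have : 0 ≤ Set.indicator (Set.Ioc (0:ℝ) ε) (1 : ℝ → ℝ) y :=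
      Set.indicator_nonneg (fun _ _ => zero_le_one) y
    positivity
  · obtain ⟨h1, h2⟩ := hψsupp h0
    have hs0 : 0 < s := hy.trans_le hs
    rw [Set.indicator_of_mem (Set.mem_Ioc.2 ⟨hy, hs.trans h2⟩), Pi.one_apply, mul_one]
    calc ψ s ≤ 2 / (s * Real.log δ) := hψbd s hs0
      _ = 2 / Real.log δ * (1 / s) := by field_simp
      _ ≤ _ := by
        gcongr
        refine le_min (one_div_le_one_div_of_le hy hs) ?_
        rw [div_le_div_iff₀ hs0 hε]
        rw [div_le_iff₀ hδ0] at h1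
        linarith

theorem statement5 (δ ε : ℝ) (hδ : 1 < δ) (hε : ε ∈ Set.Ioo (0:ℝ) 1)
    (ψ : ℝ → ℝ) (hψc : Continuous ψ) (hψ0 : ∀ z, 0 ≤ ψ z)
    (hψsupp : Function.support ψ ⊆ Set.Icc (ε / δ) ε)
    (hψint : (∫ z in (ε / δ)..ε, ψ z) = 1)
    (hψbd : ∀ z > 0, ψ z ≤ 2 / (z * Real.log δ))
    (φ φ' φ'' : ℝ → ℝ)
    (hφ : ∀ x, φ x = ∫ y in (0:ℝ)..|x|, ∫ z in (0:ℝ)..y, ψ z)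
    (hD1 : ∀ x, HasDerivAt φ (φ' x) x)
    (hD2 : ∀ x, HasDerivAt φ' (φ'' x) x)
    (hD2c : Continuous φ'') :
    ∀ x y : ℝ, y ≠ 0 → 0 ≤ x * y → ∀ z > 0,
      φ (y + x * z) - φ y - x * z * φ' y ≤
        2 * |x * z| ^ 2 / Real.log δ *
          Set.indicator (Set.Ioc (0:ℝ) ε) (1 : ℝ → ℝ) (|y|) *
          min (1 / |y|) (δ / ε) := by
  have hg : ∀ t, HasDerivAt (fun u => ∫ w in (0:ℝ)..u, ψ w) (ψ t) t := fun t =>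
    intervalIntegral.integral_hasDerivAt_right (hψc.intervalIntegrable _ _)
      hψc.stronglyMeasurable.stronglyMeasurableAtFilter hψc.continuousAt
  have hgc : Continuous fun u => ∫ w in (0:ℝ)..u, ψ w :=
    continuous_iff_continuousAt.2 fun t => (hg t).continuousAt
  have hf : ∀ t, 0 < t → HasDerivAt φ (∫ w in (0:ℝ)..t, ψ w) t := fun t ht =>
    (intervalIntegral.integral_hasDerivAt_right (hgc.intervalIntegrable 0 t)
      hgc.stronglyMeasurable.stronglyMeasurableAtFilter hgc.continuousAt).congr_of_eventuallyEq <| by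
      filter_upwards [lt_mem_nhds ht] with u hu
      rw [hφ, abs_of_pos hu]
  have hlog : 0 < Real.log δ := Real.log_pos hδ
  have key : ∀ y h : ℝ, 0 < y → 0 ≤ h → φ (y + h) - φ y - h * φ' y ≤
      2 * |h| ^ 2 / Real.log δ * Set.indicator (Set.Ioc (0:ℝ) ε) (1 : ℝ → ℝ) (|y|) *
        min (1 / |y|) (δ / ε) := by
    intro y h hy hh
    have hε0 : 0 < ε := hε.1
    have hind : 0 ≤ Set.indicator (Set.Ioc (0:ℝ) ε) (1 : ℝ → ℝ) y :=
      Set.indicator_nonneg (fun _ _ => zero_le_one) y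
    have H := sub_sub_mul_le_mul_sq (fun t ht => hf t (hy.trans_le ht)) (fun t _ => hg t)
      (fun s hs => le_mul_indicator_mul_min hδ hε0 hψsupp hψbd hy hs) (by positivity) hh
    rw [(hD1 y).unique (hf y hy), abs_of_pos hy, abs_of_nonneg hh]
    exact H.trans_eq (by ring)
  have heven : ∀ u, φ (-u) = φ u := fun u => by rw [hφ, hφ, abs_neg]
  have hodd : ∀ u, φ' (-u) = -φ' u := fun u => by
    have h1 := (hD1 (-u)).comp u (hasDerivAt_neg u)
    rw [show φ ∘ Neg.neg = φ from funext heven] at h1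
    linarith [h1.unique (hD1 u)]
  intro x y hy hxy z hz
  rcases hy.lt_or_gt with hneg | hpos
  · have hx : x ≤ 0 := by
      by_contra! hx
      linarith [mul_neg_of_pos_of_neg hx hneg]
    have H := key (-y) (-(x * z)) (by linarith)
      (neg_nonneg.2 (mul_nonpos_of_nonpos_of_nonneg hx hz.le))
    rwa [← neg_add, heven, heven, hodd, neg_mul_neg, abs_neg, abs_neg] at H
  · exact key y (x * z) hpos (mul_nonneg (nonneg_of_mul_nonneg_left hxy hpos) hz.le)
end

section
/- Let x ∈ ℝ and y ∈ ℝ \ {0} with x·y ≥ 0. Then for every z > 0, φ(y + x·z) − φ(y) − x·z·φ'(y) ≤ 1_{(0,ε]}(|y|)·|x|·z, where 1_{(0,ε]} denotes the indicator function of the interval (0,ε]. -/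
open MeasureTheory Filter Set

/-- If `G` is continuous and bounded above by `1`, its primitive exceeds its tangent line at `t`
by at most `(1 - G t) * h` after a step `h ≥ 0`. -/
lemma integral_sub_integral_sub_le {G : ℝ → ℝ} (hG : Continuous G) (hG1 : ∀ s, G s ≤ 1)
    {t h : ℝ} (hh : 0 ≤ h) :
    (∫ s in (0:ℝ)..(t + h), G s) - (∫ s in (0:ℝ)..t, G s) - h * G t ≤ (1 - G t) * h := by
  have hI : ∀ a b, IntervalIntegrable G volume a b := fun a b => hG.intervalIntegrable a b
  rw [intervalIntegral.integral_interval_sub_left (hI _ _) (hI _ _)]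
  have hle : (∫ s in t..(t + h), G s) ≤ ∫ _ in t..(t + h), (1:ℝ) :=
    intervalIntegral.integral_mono_on (by linarith) (hI _ _) (by simp) fun s _ => hG1 s
  simp only [intervalIntegral.integral_const, smul_eq_mul, mul_one, add_sub_cancel_left] at hle
  linarith

theorem statement6 (δ ε : ℝ) (hδ : 1 < δ) (hε : ε ∈ Set.Ioo (0:ℝ) 1)
    (ψ : ℝ → ℝ) (hψc : Continuous ψ) (hψ0 : ∀ z, 0 ≤ ψ z)
    (hψsupp : Function.support ψ ⊆ Set.Icc (ε / δ) ε)
    (hψint : (∫ z in (ε / δ)..ε, ψ z) = 1)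
    (hψbd : ∀ z > 0, ψ z ≤ 2 / (z * Real.log δ))
    (φ φ' φ'' : ℝ → ℝ)
    (hφ : ∀ x, φ x = ∫ y in (0:ℝ)..|x|, ∫ z in (0:ℝ)..y, ψ z)
    (hD1 : ∀ x, HasDerivAt φ (φ' x) x)
    (hD2 : ∀ x, HasDerivAt φ' (φ'' x) x)
    (hD2c : Continuous φ'') :
    ∀ x y : ℝ, y ≠ 0 → 0 ≤ x * y → ∀ z > 0,
      φ (y + x * z) - φ y - x * z * φ' y ≤
        Set.indicator (Set.Ioc (0:ℝ) ε) (1 : ℝ → ℝ) (|y|) * (|x| * z) := by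
  obtain ⟨hε0, -⟩ := hε
  have hpos : 0 < ε / δ := by positivity
  have hlt : ε / δ < ε := div_lt_self hε0 hδ
  have hsupp : Function.support ψ ⊆ Ioo (ε / δ) ε := by
    rw [← interior_Icc]
    exact interior_maximal hψsupp hψc.isOpen_support
  have htot : ∫ z, ψ z = 1 := by
    rw [← hψint]
    exact (intervalIntegral.integral_eq_integral_of_support_subset
      (hsupp.trans Ioo_subset_Ioc_self)).symm
  set G : ℝ → ℝ := fun t => ∫ z in (0:ℝ)..t, ψ z with hGdef
  have hI : ∀ a b, IntervalIntegrable ψ volume a b := fun a b => hψc.intervalIntegrable a b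
  have hGc : Continuous G := intervalIntegral.continuous_primitive hI 0
  have hG0 : ∀ t, 0 ≤ t → 0 ≤ G t := fun t ht =>
    intervalIntegral.integral_nonneg ht fun z _ => hψ0 z
  have hGeq : ∀ t, ε ≤ t → G t = 1 := fun t ht => by
    rw [← htot]
    exact intervalIntegral.integral_eq_integral_of_support_subset
      fun z hz => ⟨hpos.trans (hsupp hz).1, (hsupp hz).2.le.trans ht⟩
  have hG1 : ∀ t, G t ≤ 1 := fun t => by
    rw [← hGeq (max t ε) (le_max_right _ _), ← sub_nonneg, hGdef]
    simp only
    rw [intervalIntegral.integral_interval_sub_left (hI _ _) (hI _ _)]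
    exact intervalIntegral.integral_nonneg (le_max_left _ _) fun z _ => hψ0 z
  have hφ' : ∀ t, 0 < t → φ' t = G t := fun t ht => by
    have hd : HasDerivAt (fun u => ∫ s in (0:ℝ)..u, G s) (G t) t :=
      (hGc.integral_hasStrictDerivAt 0 t).hasDerivAt
    refine (hD1 t).unique (hd.congr_of_eventuallyEq ?_)
    filter_upwards [lt_mem_nhds ht] with u hu
    rw [hφ, abs_of_pos hu]
  have heven : ∀ t, φ (-t) = φ t := fun t => by rw [hφ, hφ, abs_neg]
  have hodd : ∀ t, φ' (-t) = -φ' t := fun t => by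
    have hd : HasDerivAt φ (-φ' (- -t)) (-t) := by
      simpa [Function.comp_def, heven] using (hD1 (- -t)).comp (-t) (hasDerivAt_neg (-t))
    simpa using (hD1 (-t)).unique hd
  have key : ∀ t, 0 < t → ∀ h, 0 ≤ h →
      φ (t + h) - φ t - h * φ' t ≤ Set.indicator (Set.Ioc (0:ℝ) ε) (1 : ℝ → ℝ) t * h := by
    intro t ht h hh
    rw [hφ' t ht, hφ, hφ, abs_of_pos ht, abs_of_nonneg (by positivity)]
    refine (integral_sub_integral_sub_le hGc hG1 hh).trans
      (mul_le_mul_of_nonneg_right ?_ hh)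
    rcases le_or_gt t ε with hle | hgt
    · rw [indicator_of_mem (mem_Ioc.2 ⟨ht, hle⟩), Pi.one_apply]
      linarith [hG0 t ht.le]
    · rw [indicator_of_notMem (fun hm : t ∈ Ioc 0 ε => hm.2.not_gt hgt), hGeq t hgt.le, sub_self]
  intro x y hy hxy z hz
  rcases hy.lt_or_gt with hneg | hpos'
  · have hx : x ≤ 0 := nonpos_of_mul_nonneg_left hxy hneg
    have hk := key (-y) (neg_pos.2 hneg) (-x * z) (mul_nonneg (neg_nonneg.2 hx) hz.le)
    rw [show -y + -x * z = -(y + x * z) by ring, heven, heven, hodd] at hk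
    rw [abs_of_neg hneg, abs_of_nonpos hx]
    linarith
  · have hx : 0 ≤ x := nonneg_of_mul_nonneg_left hxy hpos'
    rw [abs_of_pos hpos', abs_of_nonneg hx]
    exact key y hpos' (x * z) (mul_nonneg hx hz.le)
end

section
/- Let x ∈ ℝ and y ∈ ℝ \ {0} with x·y ≥ 0, and let u > 0. Then ∫₀^∞ { φ(y + x·z) − φ(y) − x·z·φ'(y) } ν(dz) ≤ 2·1_{(0,ε]}(|y|)·{ (|x|²/log δ)·min(1/|y|, δ/ε)·∫₀^u z² ν(dz) + |x|·∫_u^∞ z ν(dz) }, where 1_{(0,ε]} denotes the indicator function of the interval (0,ε]. -/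
open MeasureTheory Filter Set

/-- A nonnegative continuous function supported in `[a, b]` has integral over any interval
bounded by its integral over `[a, b]`. -/
lemma intervalIntegral_le_of_support_subset_Icc {f : ℝ → ℝ} (hf : Continuous f)
    (hf0 : ∀ z, 0 ≤ f z) {a b : ℝ} (hab : a ≤ b) (hsupp : Function.support f ⊆ Icc a b)
    {s t : ℝ} (hst : s ≤ t) : ∫ z in s..t, f z ≤ ∫ z in a..b, f z := by
  have hzero : ∀ z, z ∉ Icc a b → f z = 0 := fun z hz => by
    by_contra h
    exact hz (hsupp h)
  have hint : Integrable f :=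
    hf.integrable_of_hasCompactSupport (HasCompactSupport.intro isCompact_Icc hzero)
  rw [intervalIntegral.integral_of_le hst, intervalIntegral.integral_of_le hab,
    ← integral_Icc_eq_integral_Ioc (x := a),
    setIntegral_eq_integral_of_forall_compl_eq_zero hzero]
  exact setIntegral_le_integral hint (Eventually.of_forall hf0)

/-- The derivative at `y ≠ 0` of the even extension of the double primitive of `f`. -/
lemma hasDerivAt_doublePrimitive_abs {f : ℝ → ℝ} (hf : Continuous f) {y : ℝ} (hy : y ≠ 0) :
    HasDerivAt (fun x : ℝ => ∫ s in (0 : ℝ)..|x|, ∫ z in (0 : ℝ)..s, f z)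
      ((∫ z in (0 : ℝ)..|y|, f z) * (SignType.sign y : ℝ)) y := by
  have hc : Continuous fun s : ℝ => ∫ z in (0 : ℝ)..s, f z :=
    intervalIntegral.continuous_primitive (fun _ _ => hf.intervalIntegrable _ _) 0
  have h1 : HasDerivAt (fun t : ℝ => ∫ s in (0 : ℝ)..t, ∫ z in (0 : ℝ)..s, f z)
      (∫ z in (0 : ℝ)..|y|, f z) |y| :=
    intervalIntegral.integral_hasDerivAt_right (hc.intervalIntegrable _ _)
      (hc.stronglyMeasurableAtFilter _ _) hc.continuousAt
  exact h1.comp y (hasDerivAt_abs hy)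

/-- Second-order remainder of the double primitive of `f`, bounded by the increment of the
first primitive. -/
lemma doublePrimitive_remainder_le {f : ℝ → ℝ} (hf : Continuous f) (hf0 : ∀ z, 0 ≤ f z)
    {a h : ℝ} (hh : 0 ≤ h) :
    (∫ s in (0 : ℝ)..(a + h), ∫ z in (0 : ℝ)..s, f z) - (∫ s in (0 : ℝ)..a, ∫ z in (0 : ℝ)..s, f z)
      - h * (∫ z in (0 : ℝ)..a, f z) ≤ h * ∫ z in a..(a + h), f z := by
  have hi : ∀ p q, IntervalIntegrable f volume p q := fun _ _ => hf.intervalIntegrable _ _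
  have hc : Continuous fun s : ℝ => ∫ z in (0 : ℝ)..s, f z :=
    intervalIntegral.continuous_primitive hi 0
  rw [intervalIntegral.integral_interval_sub_left (hc.intervalIntegrable _ _)
    (hc.intervalIntegrable _ _), ← intervalIntegral.integral_interval_sub_left (hi 0 (a + h)) (hi 0 a)]
  have : ∫ s in a..(a + h), (∫ z in (0 : ℝ)..s, f z) ≤
      ∫ _s in a..(a + h), (∫ z in (0 : ℝ)..(a + h), f z) := by
    refine intervalIntegral.integral_mono_on (by linarith) (hc.intervalIntegrable _ _)
      intervalIntegrable_const fun s hs => ?_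
    have h2 := intervalIntegral.integral_interval_sub_left (hi 0 (a + h)) (hi 0 s)
    have h3 : 0 ≤ ∫ z in s..(a + h), f z :=
      intervalIntegral.integral_nonneg hs.2 fun z _ => hf0 z
    linarith
  rw [intervalIntegral.integral_const, smul_eq_mul] at this
  linarith

/-- If `z ∧ z²` has finite integral on `(0, ∞)`, then it is integrable there. -/
lemma integrableOn_min_of_lintegral_lt_top {ν : Measure ℝ}
    (h : (∫⁻ z in Ioi (0 : ℝ), ENNReal.ofReal (min z (z ^ 2)) ∂ν) < ⊤) :
    IntegrableOn (fun z : ℝ => min z (z ^ 2)) (Ioi 0) ν := by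
  refine ⟨by fun_prop, ?_⟩
  rw [hasFiniteIntegral_iff_ofReal]
  · exact h
  · filter_upwards [ae_restrict_mem measurableSet_Ioi] with z hz
    exact le_min (le_of_lt hz) (sq_nonneg z)

lemma integrableOn_sq_Ioc {ν : Measure ℝ}
    (h : IntegrableOn (fun z : ℝ => min z (z ^ 2)) (Ioi 0) ν) (u : ℝ) :
    IntegrableOn (fun z : ℝ => z ^ 2) (Ioc 0 u) ν := by
  refine ((h.mono_set Ioc_subset_Ioi_self).const_mul (max 1 u)).mono' (by fun_prop) ?_
  filter_upwards [ae_restrict_mem measurableSet_Ioc] with z hz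
  obtain ⟨hz0, hzu⟩ := hz
  rw [Real.norm_of_nonneg (sq_nonneg z)]
  rcases le_total z 1 with h1 | h1
  · rw [min_eq_right (by nlinarith)]
    exact le_mul_of_one_le_left (sq_nonneg z) (le_max_left _ _)
  · rw [min_eq_left (by nlinarith), sq]
    exact mul_le_mul_of_nonneg_right (hzu.trans (le_max_right _ _)) hz0.le

lemma integrableOn_id_Ioi {ν : Measure ℝ}
    (h : IntegrableOn (fun z : ℝ => min z (z ^ 2)) (Ioi 0) ν) {u : ℝ} (hu : 0 < u) :
    IntegrableOn (fun z : ℝ => z) (Ioi u) ν := by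
  refine ((h.mono_set (Ioi_subset_Ioi hu.le)).const_mul (max 1 u⁻¹)).mono' (by fun_prop) ?_
  filter_upwards [ae_restrict_mem measurableSet_Ioi] with z hz
  have hz0 : 0 < z := hu.trans hz
  rw [Real.norm_of_nonneg hz0.le]
  rcases le_total z 1 with h1 | h1
  · rw [min_eq_right (by nlinarith)]
    calc z = u⁻¹ * (u * z) := by field_simp
      _ ≤ u⁻¹ * z ^ 2 := by
        rw [sq]
        exact mul_le_mul_of_nonneg_left (mul_le_mul_of_nonneg_right (le_of_lt hz) hz0.le)
          (inv_nonneg.2 hu.le)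
      _ ≤ _ := mul_le_mul_of_nonneg_right (le_max_right _ _) (sq_nonneg z)
  · rw [min_eq_left (by nlinarith)]
    exact le_mul_of_one_le_left hz0.le (le_max_left _ _)

/-- A function dominated by `A z²` on `(0, u]` and by `B z` on `(u, ∞)` has its integral
dominated accordingly. -/
lemma lintegral_ofReal_le_of_le_sq_of_le_id {ν : Measure ℝ}
    (h : IntegrableOn (fun z : ℝ => min z (z ^ 2)) (Ioi 0) ν) {u : ℝ} (hu : 0 < u)
    {F : ℝ → ℝ} {A B : ℝ} (hA : 0 ≤ A) (hB : 0 ≤ B)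
    (hFA : ∀ z > 0, F z ≤ A * z ^ 2) (hFB : ∀ z > 0, F z ≤ B * z) :
    ∫⁻ z in Ioi (0 : ℝ), ENNReal.ofReal (F z) ∂ν ≤
      ENNReal.ofReal (A * (∫ z in Ioc (0 : ℝ) u, z ^ 2 ∂ν) + B * ∫ z in Ioi u, z ∂ν) := by
  have h1 : ∫⁻ z in Ioc (0 : ℝ) u, ENNReal.ofReal (F z) ∂ν ≤
      ENNReal.ofReal (A * ∫ z in Ioc (0 : ℝ) u, z ^ 2 ∂ν) := by
    rw [← integral_const_mul, ofReal_integral_eq_lintegral_ofReal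
      ((integrableOn_sq_Ioc h u).const_mul A)
      (Eventually.of_forall fun z => mul_nonneg hA (sq_nonneg z))]
    exact setLIntegral_mono' measurableSet_Ioc fun z hz => ENNReal.ofReal_le_ofReal (hFA z hz.1)
  have h2 : ∫⁻ z in Ioi u, ENNReal.ofReal (F z) ∂ν ≤
      ENNReal.ofReal (B * ∫ z in Ioi u, z ∂ν) := by
    rw [← integral_const_mul, ofReal_integral_eq_lintegral_ofReal
      ((integrableOn_id_Ioi h hu).const_mul B)]
    · exact setLIntegral_mono' measurableSet_Ioi fun z hz =>
        ENNReal.ofReal_le_ofReal (hFB z (hu.trans hz))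
    · filter_upwards [ae_restrict_mem measurableSet_Ioi] with z hz
      exact mul_nonneg hB (hu.trans hz).le
  rw [← Ioc_union_Ioi_eq_Ioi hu.le, ENNReal.ofReal_add]
  · exact (lintegral_union_le _ _ _).trans (add_le_add h1 h2)
  · exact mul_nonneg hA (setIntegral_nonneg measurableSet_Ioc fun z _ => sq_nonneg z)
  · exact mul_nonneg hB (setIntegral_nonneg measurableSet_Ioi fun z hz => (hu.trans hz).le)

theorem statement7 (δ ε : ℝ) (hδ : 1 < δ) (hε : ε ∈ Set.Ioo (0:ℝ) 1)
    (ψ : ℝ → ℝ) (hψc : Continuous ψ) (hψ0 : ∀ z, 0 ≤ ψ z)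
    (hψsupp : Function.support ψ ⊆ Set.Icc (ε / δ) ε)
    (hψint : (∫ z in (ε / δ)..ε, ψ z) = 1)
    (hψbd : ∀ z > 0, ψ z ≤ 2 / (z * Real.log δ))
    (φ φ' φ'' : ℝ → ℝ)
    (hφ : ∀ x, φ x = ∫ y in (0:ℝ)..|x|, ∫ z in (0:ℝ)..y, ψ z)
    (hD1 : ∀ x, HasDerivAt φ (φ' x) x)
    (hD2 : ∀ x, HasDerivAt φ' (φ'' x) x)
    (hD2c : Continuous φ'')
    (ν : MeasureTheory.Measure ℝ) (hν0 : ν (Set.Iic (0:ℝ)) = 0)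
    (hνfin : (∫⁻ z in Set.Ioi (0:ℝ), ENNReal.ofReal (min z (z^2)) ∂ν) < ⊤) :
    ∀ x y : ℝ, y ≠ 0 → 0 ≤ x * y → ∀ u > 0,
      (∫⁻ z in Set.Ioi (0:ℝ),
          ENNReal.ofReal (φ (y + x * z) - φ y - x * z * φ' y) ∂ν) ≤
        ENNReal.ofReal (2 * Set.indicator (Set.Ioc (0:ℝ) ε) (1 : ℝ → ℝ) (|y|) *
          ((|x| ^ 2 / Real.log δ) * min (1 / |y|) (δ / ε) * (∫ z in Set.Ioc (0:ℝ) u, z ^ 2 ∂ν)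
            + |x| * (∫ z in Set.Ioi u, z ∂ν))) := by
  intro x y hy hxy u hu
  obtain ⟨hε0, -⟩ := hε
  have hlog : 0 < Real.log δ := Real.log_pos hδ
  have hδ0 : 0 < δ := one_pos.trans hδ
  have hay : 0 < |y| := abs_pos.2 hy
  set I : ℝ := Set.indicator (Set.Ioc (0:ℝ) ε) (1 : ℝ → ℝ) (|y|) with hI
  set m : ℝ := min (1 / |y|) (δ / ε) with hm
  have hI0 : 0 ≤ I := Set.indicator_nonneg (fun _ _ => zero_le_one) _
  have hm0 : 0 ≤ m := le_min (by positivity) (by positivity)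
  have hψzero : ∀ z, z ∉ Set.Icc (ε / δ) ε → ψ z = 0 := fun z hz => by
    by_contra h
    exact hz (hψsupp h)
  have hbound : ∀ z, |y| < z → ψ z ≤ I * (2 / Real.log δ * m) := by
    intro z hz
    have hz0 : 0 < z := hay.trans hz
    by_cases hzs : z ∈ Set.Icc (ε / δ) ε
    · rw [hI, Set.indicator_of_mem (show |y| ∈ Set.Ioc 0 ε from ⟨hay, hz.le.trans hzs.2⟩), Pi.one_apply, one_mul]
      have hzm : 1 / z ≤ m := by
        refine le_min (one_div_le_one_div_of_le hay hz.le) ?_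
        rw [← one_div_div ε δ]
        exact one_div_le_one_div_of_le (by positivity) hzs.1
      calc ψ z ≤ 2 / (z * Real.log δ) := hψbd z hz0
        _ = 2 / Real.log δ * (1 / z) := by field_simp
        _ ≤ _ := mul_le_mul_of_nonneg_left hzm (by positivity)
    · rw [hψzero z hzs]
      positivity
  have hinc_le : ∀ h, 0 ≤ h → ∫ z in |y|..(|y| + h), ψ z ≤ I * (2 / Real.log δ * m) * h := by
    intro h hh
    calc ∫ z in |y|..(|y| + h), ψ z ≤ ∫ _z in |y|..(|y| + h), I * (2 / Real.log δ * m) :=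
          intervalIntegral.integral_mono_on_of_le_Ioo (by linarith)
            (hψc.intervalIntegrable _ _) intervalIntegrable_const fun z hz => hbound z hz.1
      _ = _ := by rw [intervalIntegral.integral_const, smul_eq_mul]; ring
  have hinc_le_one : ∀ h, 0 ≤ h → ∫ z in |y|..(|y| + h), ψ z ≤ I := by
    intro h hh
    by_cases hyε : |y| ≤ ε
    · rw [hI, Set.indicator_of_mem (show |y| ∈ Set.Ioc 0 ε from ⟨hay, hyε⟩), Pi.one_apply, ← hψint]
      exact intervalIntegral_le_of_support_subset_Icc hψc hψ0
        (div_le_self hε0.le hδ.le) hψsupp (by linarith)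
    · have hI' : I = 0 := Set.indicator_of_notMem (fun h => hyε h.2) _
      simpa [hI'] using hinc_le h hh
  have hrem : ∀ z > 0, φ (y + x * z) - φ y - x * z * φ' y ≤
      (|x| * z) * ∫ t in |y|..(|y| + |x| * z), ψ t := by
    intro z hz
    have hφ' : φ' y = (∫ z in (0 : ℝ)..|y|, ψ z) * (SignType.sign y : ℝ) := by
      refine (hD1 y).unique ?_
      rw [funext hφ]
      exact hasDerivAt_doublePrimitive_abs hψc hy
    have hsign : x * (SignType.sign y : ℝ) = |x| := by
      rcases hy.lt_or_gt with h | h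
      · have : x ≤ 0 := by
          by_contra! h'
          nlinarith
        simp [sign_neg h, abs_of_nonpos this]
      · have : 0 ≤ x := nonneg_of_mul_nonneg_left hxy h
        simp [sign_pos h, abs_of_nonneg this]
    have habs : |y + x * z| = |y| + |x| * z := by
      rw [← abs_of_pos hz, ← abs_mul, abs_of_pos hz]
      refine abs_add_eq_add_abs_iff _ _ |>.2 ?_
      rw [← mul_nonneg_iff]
      nlinarith [mul_nonneg hxy hz.le]
    have := doublePrimitive_remainder_le hψc hψ0 (a := |y|) (h := |x| * z) (by positivity)
    rw [hφ, hφ, hφ', habs]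
    calc _ = _ := by rw [← hsign]; ring
      _ ≤ _ := this
  have key := lintegral_ofReal_le_of_le_sq_of_le_id (integrableOn_min_of_lintegral_lt_top hνfin) hu
    (F := fun z => φ (y + x * z) - φ y - x * z * φ' y)
    (A := 2 * I * (|x| ^ 2 / Real.log δ * m)) (B := 2 * I * |x|) (by positivity) (by positivity)
    (fun z hz => (hrem z hz).trans ?_) (fun z hz => (hrem z hz).trans ?_)
  · refine key.trans_eq (congrArg ENNReal.ofReal ?_)
    ring
  · have hxz : 0 ≤ |x| * z := by positivity
    calc _ ≤ (|x| * z) * (I * (2 / Real.log δ * m) * (|x| * z)) :=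
          mul_le_mul_of_nonneg_left (hinc_le _ hxz) hxz
      _ = _ := by ring
  · have hxz : 0 ≤ |x| * z := by positivity
    calc _ ≤ (|x| * z) * I := mul_le_mul_of_nonneg_left (hinc_le_one _ hxz) hxz
      _ ≤ _ := by nlinarith [mul_nonneg hI0 hxz]
end

section
/- Let x, x', y ∈ ℝ and let u ∈ (0,∞). Then ∫₀^∞ | φ(y + x·z) − φ(y + x'·z) − (x − x')·z·φ'(y) | ν(dz) ≤ 2·{ δ·(|x − x'|² + |x'|·|x − x'|)/(ε·log δ)·∫₀^u z² ν(dz) + |x − x'|·∫_u^∞ z ν(dz) }. -/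
open MeasureTheory Filter Set

/-- The primitive of a nonnegative continuous function carried by `[a, b]` is at most its mass. -/
lemma intervalIntegral_le_mass_of_support {ψ : ℝ → ℝ} {a b : ℝ} (hab : a ≤ b)
    (hc : Continuous ψ) (h0 : ∀ z, 0 ≤ ψ z) (hs : Function.support ψ ⊆ Icc a b)
    {x : ℝ} (hx : 0 ≤ x) : (∫ z in (0:ℝ)..x, ψ z) ≤ ∫ z in a..b, ψ z := by
  have hz : ∀ z, z ∉ Icc a b → ψ z = 0 := fun z hz => by
    by_contra h
    exact hz (hs h)
  have hi : Integrable ψ :=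
    hc.integrable_of_hasCompactSupport (HasCompactSupport.intro isCompact_Icc fun z h => hz z h)
  rw [intervalIntegral.integral_of_le hx, intervalIntegral.integral_of_le hab,
    ← integral_Icc_eq_integral_Ioc (x := a), setIntegral_eq_integral_of_forall_compl_eq_zero hz]
  exact setIntegral_le_integral hi (Eventually.of_forall h0)

/-- The derivative of an even function is odd. -/
lemma HasDerivAt.odd_of_even {f f' : ℝ → ℝ} (hf : ∀ x, f (-x) = f x)
    (hd : ∀ x, HasDerivAt f (f' x) x) (x : ℝ) : f' (-x) = -f' x := by
  have h1 : HasDerivAt (fun t => f (-t)) (-f' (-x)) x := by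
    simpa [Function.comp_def] using (hd (-x)).comp x (hasDerivAt_neg x)
  rw [show (fun t => f (-t)) = f from funext hf] at h1
  linarith [h1.unique (hd x)]

/-- The derivative of an odd function is even. -/
lemma HasDerivAt.even_of_odd {f f' : ℝ → ℝ} (hf : ∀ x, f (-x) = -f x)
    (hd : ∀ x, HasDerivAt f (f' x) x) (x : ℝ) : f' (-x) = f' x := by
  have h1 : HasDerivAt (fun t => f (-t)) (-f' (-x)) x := by
    simpa [Function.comp_def] using (hd (-x)).comp x (hasDerivAt_neg x)
  rw [show (fun t => f (-t)) = fun t => -f t from funext hf] at h1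
  linarith [h1.unique (hd x).neg]

/-- A function with derivative bounded by `C` is `C`-Lipschitz. -/
lemma abs_sub_le_of_hasDerivAt_of_abs_le {f f' : ℝ → ℝ} {C : ℝ}
    (hd : ∀ x, HasDerivAt f (f' x) x) (hC : ∀ x, |f' x| ≤ C) (a b : ℝ) :
    |f a - f b| ≤ C * |a - b| := by
  simpa [Real.norm_eq_abs] using
    convex_univ.norm_image_sub_le_of_norm_hasDerivWithin_le (f := f) (f' := f')
      (fun x _ => (hd x).hasDerivWithinAt) (fun x _ => by simpa using hC x)
      (mem_univ b) (mem_univ a)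

/-- Second-order bound for the increment of `f` minus its linearisation at a third point. -/
lemma abs_sub_sub_mul_le_of_abs_deriv_sub_le {f f' : ℝ → ℝ} {C : ℝ} (hC : 0 ≤ C)
    (hd : ∀ x, HasDerivAt f (f' x) x) (hL : ∀ a b, |f' a - f' b| ≤ C * |a - b|) (a b y : ℝ) :
    |f a - f b - (a - b) * f' y| ≤ C * (|a - b| + |b - y|) * |a - b| := by
  have h := (convex_uIcc a b).norm_image_sub_le_of_norm_hasDerivWithin_le
    (f := fun t => f t - t * f' y) (f' := fun t => f' t - 1 * f' y)
    (C := C * (|a - b| + |b - y|))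
    (fun t _ => ((hd t).sub ((hasDerivAt_id t).mul_const (f' y))).hasDerivWithinAt)
    (fun t ht => by
      rw [Real.norm_eq_abs, one_mul]
      refine (hL t y).trans (mul_le_mul_of_nonneg_left ?_ hC)
      have h1 : |t - b| ≤ |a - b| := by
        rw [uIcc_comm] at ht
        exact abs_sub_left_of_mem_uIcc ht
      exact (abs_sub_le t b y).trans (by linarith))
    right_mem_uIcc left_mem_uIcc
  simp only [Real.norm_eq_abs] at h
  convert h using 2
  ring

/-- If `min z (z ^ 2)` is integrable on `(0, ∞)`, then `z ^ 2` is integrable on `(0, u]`. -/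
lemma integrableOn_sq_Ioc_of_min_sq {ν : Measure ℝ} {u : ℝ} (hu : 0 < u)
    (h : IntegrableOn (fun z : ℝ => min z (z ^ 2)) (Ioi 0) ν) :
    IntegrableOn (fun z : ℝ => z ^ 2) (Ioc 0 u) ν := by
  refine Integrable.mono' ((h.mono_set Ioc_subset_Ioi_self).const_mul (u + 1))
    (by fun_prop) ?_
  filter_upwards [ae_restrict_mem measurableSet_Ioc] with z hz
  rw [Real.norm_of_nonneg (sq_nonneg z)]
  rcases min_cases z (z ^ 2) with ⟨h, _⟩ | ⟨h, _⟩ <;> rw [h] <;>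
    nlinarith [hz.1, hz.2, mul_pos hz.1 hu, sq_nonneg z, mul_nonneg hz.1.le (sub_nonneg.2 hz.2)]

/-- If `min z (z ^ 2)` is integrable on `(0, ∞)`, then `z` is integrable on `(u, ∞)`. -/
lemma integrableOn_id_Ioi_of_min_sq {ν : Measure ℝ} {u : ℝ} (hu : 0 < u)
    (h : IntegrableOn (fun z : ℝ => min z (z ^ 2)) (Ioi 0) ν) :
    IntegrableOn (fun z : ℝ => z) (Ioi u) ν := by
  refine Integrable.mono' ((h.mono_set (Ioi_subset_Ioi hu.le)).const_mul (1 + u⁻¹))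
    (by fun_prop) ?_
  filter_upwards [ae_restrict_mem measurableSet_Ioi] with z hz
  have hz : u < z := hz
  have hz0 : 0 < z := hu.trans hz
  rw [Real.norm_of_nonneg hz0.le]
  have hu' : 0 < u⁻¹ := inv_pos.2 hu
  have h1 : 1 ≤ u⁻¹ * z := by
    rw [← inv_mul_cancel₀ hu.ne']
    exact mul_le_mul_of_nonneg_left hz.le hu'.le
  rcases min_cases z (z ^ 2) with ⟨h, _⟩ | ⟨h, _⟩ <;> rw [h]
  · nlinarith [mul_pos hu' hz0]
  · nlinarith [mul_le_mul_of_nonneg_right h1 hz0.le, sq_nonneg z]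

theorem statement8 (δ ε : ℝ) (hδ : 1 < δ) (hε : ε ∈ Set.Ioo (0:ℝ) 1)
    (ψ : ℝ → ℝ) (hψc : Continuous ψ) (hψ0 : ∀ z, 0 ≤ ψ z)
    (hψsupp : Function.support ψ ⊆ Set.Icc (ε / δ) ε)
    (hψint : (∫ z in (ε / δ)..ε, ψ z) = 1)
    (hψbd : ∀ z > 0, ψ z ≤ 2 / (z * Real.log δ))
    (φ φ' φ'' : ℝ → ℝ)
    (hφ : ∀ x, φ x = ∫ y in (0:ℝ)..|x|, ∫ z in (0:ℝ)..y, ψ z)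
    (hD1 : ∀ x, HasDerivAt φ (φ' x) x)
    (hD2 : ∀ x, HasDerivAt φ' (φ'' x) x)
    (hD2c : Continuous φ'')
    (ν : MeasureTheory.Measure ℝ) (hν0 : ν (Set.Iic (0:ℝ)) = 0)
    (hνfin : (∫⁻ z in Set.Ioi (0:ℝ), ENNReal.ofReal (min z (z^2)) ∂ν) < ⊤) :
    ∀ x x' y : ℝ, ∀ u > 0,
      (∫⁻ z in Set.Ioi (0:ℝ),
          ENNReal.ofReal (|φ (y + x * z) - φ (y + x' * z) - (x - x') * z * φ' y|) ∂ν) ≤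
        ENNReal.ofReal (2 *
          (δ * (|x - x'| ^ 2 + |x'| * |x - x'|) / (ε * Real.log δ) *
              (∫ z in Set.Ioc (0:ℝ) u, z ^ 2 ∂ν)
            + |x - x'| * (∫ z in Set.Ioi u, z ∂ν))) := by
  obtain ⟨hε0, -⟩ := hε
  have hδ0 : 0 < δ := one_pos.trans hδ
  have hlog : 0 < Real.log δ := Real.log_pos hδ
  have ha : 0 < ε / δ := div_pos hε0 hδ0
  have hab : ε / δ ≤ ε := div_le_self hε0.le hδ.le
  set C : ℝ := 2 * δ / (ε * Real.log δ) with hCdef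
  have hC : 0 ≤ C := by positivity
  have hψC : ∀ z, ψ z ≤ C := by
    intro z
    by_cases hz : ψ z = 0
    · rwa [hz]
    · have hz1 : ε / δ ≤ z := (hψsupp hz).1
      refine (hψbd z (ha.trans_le hz1)).trans ?_
      calc 2 / (z * Real.log δ) ≤ 2 / (ε / δ * Real.log δ) := by gcongr
        _ = C := by rw [hCdef]; field_simp
  have hΨ : ∀ x, HasDerivAt (fun y => ∫ z in (0:ℝ)..y, ψ z) (ψ x) x := fun x =>
    hψc.integral_hasStrictDerivAt 0 x |>.hasDerivAt
  have hΨc : Continuous fun y => ∫ z in (0:ℝ)..y, ψ z :=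
    continuous_iff_continuousAt.2 fun x => (hΨ x).continuousAt
  have hφ'pos : ∀ x, 0 < x → φ' x = ∫ z in (0:ℝ)..x, ψ z := by
    intro x hx
    refine (hD1 x).unique ((hΨc.integral_hasStrictDerivAt 0 x).hasDerivAt.congr_of_eventuallyEq ?_)
    filter_upwards [lt_mem_nhds hx] with t ht
    rw [hφ, abs_of_pos ht]
  have hφ''pos : ∀ x, 0 < x → φ'' x = ψ x := by
    intro x hx
    refine (hD2 x).unique ((hΨ x).congr_of_eventuallyEq ?_)
    filter_upwards [lt_mem_nhds hx] with t ht using hφ'pos t ht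
  have hodd : ∀ x, φ' (-x) = -φ' x :=
    HasDerivAt.odd_of_even (fun x => by rw [hφ, hφ, abs_neg]) hD1
  have heven : ∀ x, φ'' (-x) = φ'' x := HasDerivAt.even_of_odd hodd hD2
  have hb1pos : ∀ x, 0 < x → |φ' x| ≤ 1 := by
    intro x hx
    rw [hφ'pos x hx, abs_of_nonneg (intervalIntegral.integral_nonneg hx.le fun z _ => hψ0 z),
      ← hψint]
    exact intervalIntegral_le_mass_of_support hab hψc hψ0 hψsupp hx.le
  have hb1 : ∀ x, |φ' x| ≤ 1 := by
    intro x
    rcases lt_trichotomy x 0 with hx | rfl | hx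
    · rw [← abs_neg, ← hodd]
      exact hb1pos _ (neg_pos.2 hx)
    · have h0 : φ' 0 = 0 := by
        have := hodd 0
        rw [neg_zero] at this
        linarith
      simp [h0]
    · exact hb1pos x hx
  have hb2pos : ∀ x, 0 < x → |φ'' x| ≤ C := by
    intro x hx
    rw [hφ''pos x hx, abs_of_nonneg (hψ0 x)]
    exact hψC x
  have hb2 : ∀ x, |φ'' x| ≤ C := by
    intro x
    have hcl : IsClosed {x | |φ'' x| ≤ C} := isClosed_le hD2c.abs continuous_const
    have hsub : ({0}ᶜ : Set ℝ) ⊆ {x | |φ'' x| ≤ C} := by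
      intro t ht
      rcases lt_or_gt_of_ne (show t ≠ 0 from ht) with h | h
      · have := hb2pos _ (neg_pos.2 h)
        rwa [heven] at this
      · exact hb2pos t h
    exact closure_minimal hsub hcl (dense_compl_singleton (0:ℝ) x)
  have hL1 := abs_sub_le_of_hasDerivAt_of_abs_le hD1 hb1
  have hL2 := abs_sub_le_of_hasDerivAt_of_abs_le hD2 hb2
  intro x x' y u hu
  set F : ℝ → ℝ := fun z => |φ (y + x * z) - φ (y + x' * z) - (x - x') * z * φ' y|
  set A : ℝ := C * (|x - x'| + |x'|) * |x - x'|
  set B : ℝ := 2 * |x - x'|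
  have hA : 0 ≤ A := by positivity
  have hB : 0 ≤ B := by positivity
  have hdiff : ∀ z, 0 < z → |(y + x * z) - (y + x' * z)| = |x - x'| * z := by
    intro z hz
    rw [show (y + x * z) - (y + x' * z) = (x - x') * z by ring, abs_mul, abs_of_pos hz]
  have hsmall : ∀ z, 0 < z → F z ≤ A * z ^ 2 := by
    intro z hz
    have h := abs_sub_sub_mul_le_of_abs_deriv_sub_le hC hD1 hL2 (y + x * z) (y + x' * z) y
    rw [hdiff z hz, show (y + x' * z) - y = x' * z by ring, abs_mul x', abs_of_pos hz,
      show (y + x * z) - (y + x' * z) = (x - x') * z by ring] at h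
    exact h.trans_eq (by simp only [A]; ring)
  have hlarge : ∀ z, 0 < z → F z ≤ B * z := by
    intro z hz
    have h := hL1 (y + x * z) (y + x' * z)
    rw [hdiff z hz, one_mul] at h
    have h2 : |(x - x') * z * φ' y| ≤ |x - x'| * z := by
      rw [abs_mul, abs_mul, abs_of_pos hz]
      exact mul_le_of_le_one_right (by positivity) (hb1 y)
    refine (abs_sub _ _).trans ?_
    simp only [B]
    linarith
  have hmin : IntegrableOn (fun z : ℝ => min z (z ^ 2)) (Ioi 0) ν := by
    refine ⟨by fun_prop, ?_⟩
    rw [hasFiniteIntegral_iff_ofReal]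
    · exact hνfin
    · filter_upwards [ae_restrict_mem measurableSet_Ioi] with z hz
      exact le_min (le_of_lt hz) (sq_nonneg z)
  have hi1 := (integrableOn_sq_Ioc_of_min_sq hu hmin).const_mul A
  have hi2 := (integrableOn_id_Ioi_of_min_sq hu hmin).const_mul B
  have hb_Ioc : (∫⁻ z in Ioc 0 u, ENNReal.ofReal (F z) ∂ν)
      ≤ ENNReal.ofReal (A * ∫ z in Ioc 0 u, z ^ 2 ∂ν) := by
    rw [← integral_const_mul, ofReal_integral_eq_lintegral_ofReal hi1
      (Eventually.of_forall fun z => mul_nonneg hA (sq_nonneg z))]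
    exact setLIntegral_mono' measurableSet_Ioc fun z hz =>
      ENNReal.ofReal_le_ofReal (hsmall z hz.1)
  have hpos : ∀ᵐ z ∂(ν.restrict (Ioi u)), 0 ≤ z := by
    filter_upwards [ae_restrict_mem measurableSet_Ioi] with z hz
    exact (hu.trans hz).le
  have hb_Ioi : (∫⁻ z in Ioi u, ENNReal.ofReal (F z) ∂ν)
      ≤ ENNReal.ofReal (B * ∫ z in Ioi u, z ∂ν) := by
    rw [← integral_const_mul, ofReal_integral_eq_lintegral_ofReal hi2
      (hpos.mono fun z hz => mul_nonneg hB hz)]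
    exact setLIntegral_mono' measurableSet_Ioi fun z hz =>
      ENNReal.ofReal_le_ofReal (hlarge z (hu.trans hz))
  rw [← Ioc_union_Ioi_eq_Ioi hu.le]
  refine (lintegral_union_le _ _ _).trans ((add_le_add hb_Ioc hb_Ioi).trans_eq ?_)
  rw [← ENNReal.ofReal_add (mul_nonneg hA (integral_nonneg fun z => sq_nonneg z))
    (mul_nonneg hB (integral_nonneg_of_ae hpos))]
  congr 1
  simp only [A, B, hCdef]
  ring
end

section
/- Let x, x', y ∈ ℝ. Then for every z > 0, | φ(y + x·z) − φ(y + x'·z) − (x − x')·z·φ'(y) | ≤ (|x − x'|² + |x'|·|x − x'|)·z²·2δ/(ε·log δ). -/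
open MeasureTheory Filter Set

/-- A second-order remainder estimate: if the derivative of `f` is `M`-Lipschitz, then replacing
the increment of `f` from `a` to `b` by its linear part at `y` costs at most
`M (|b - a| + |a - y|) |b - a|`. -/
lemma abs_sub_sub_mul_deriv_le {f f' : ℝ → ℝ} {M : ℝ} (hf : ∀ x, HasDerivAt f (f' x) x)
    (hM : 0 ≤ M) (hlip : ∀ a b, |f' a - f' b| ≤ M * |a - b|) (a b y : ℝ) :
    |f b - f a - (b - a) * f' y| ≤ M * (|b - a| + |a - y|) * |b - a| := by
  have hg : ∀ t ∈ Set.uIcc a b, HasDerivWithinAt (fun t => f t - t * f' y) (f' t - f' y)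
      (Set.uIcc a b) t := fun t _ => by
    have h := (hf t).sub ((hasDerivAt_id t).mul_const (f' y))
    rw [one_mul] at h
    exact h.hasDerivWithinAt
  have hbound : ∀ t ∈ Set.uIcc a b, ‖f' t - f' y‖ ≤ M * (|b - a| + |a - y|) := fun t ht => by
    have h₁ := Set.abs_sub_left_of_mem_uIcc ht
    have h₂ := abs_sub_le t a y
    calc ‖f' t - f' y‖ ≤ M * |t - y| := hlip t y
      _ ≤ M * (|b - a| + |a - y|) := mul_le_mul_of_nonneg_left (by linarith) hM
  have h := (convex_uIcc a b).norm_image_sub_le_of_norm_hasDerivWithin_le hg hbound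
    Set.left_mem_uIcc Set.right_mem_uIcc
  have e : f b - f a - (b - a) * f' y = (f b - b * f' y) - (f a - a * f' y) := by ring
  rw [e]
  exact h

/-- On the positive half-line, the second derivative of the even double primitive of `ψ` is `ψ`. -/
lemma second_deriv_double_primitive_abs {ψ φ φ' φ'' : ℝ → ℝ} (hψ : Continuous ψ)
    (hφ : ∀ x, φ x = ∫ y in (0:ℝ)..|x|, ∫ z in (0:ℝ)..y, ψ z)
    (hD1 : ∀ x, HasDerivAt φ (φ' x) x) (hD2 : ∀ x, HasDerivAt φ' (φ'' x) x)
    {x : ℝ} (hx : 0 < x) : φ'' x = ψ x := by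
  have hF : ∀ t, HasDerivAt (fun y => ∫ z in (0:ℝ)..y, ψ z) (ψ t) t := fun t =>
    hψ.integral_hasStrictDerivAt 0 t |>.hasDerivAt
  have hFc : Continuous fun y => ∫ z in (0:ℝ)..y, ψ z :=
    continuous_iff_continuousAt.2 fun t => (hF t).continuousAt
  have hφ' : ∀ t > 0, φ' t = ∫ z in (0:ℝ)..t, ψ z := fun t ht => by
    refine (hD1 t).unique ((hFc.integral_hasStrictDerivAt 0 t).hasDerivAt.congr_of_eventuallyEq ?_)
    filter_upwards [lt_mem_nhds ht] with s hs
    rw [hφ, abs_of_pos hs]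
  refine (hD2 x).unique ((hF x).congr_of_eventuallyEq ?_)
  filter_upwards [lt_mem_nhds hx] with s hs using hφ' s hs

/-- The second derivative of an even function is even. -/
lemma second_deriv_neg_of_even {φ φ' φ'' : ℝ → ℝ} (heven : ∀ x, φ (-x) = φ x)
    (hD1 : ∀ x, HasDerivAt φ (φ' x) x) (hD2 : ∀ x, HasDerivAt φ' (φ'' x) x) (x : ℝ) :
    φ'' (-x) = φ'' x := by
  have hodd : ∀ t, φ' t = -φ' (-t) := fun t => by
    have h := (hD1 (-t)).scomp t (hasDerivAt_neg t)
    have e : φ ∘ Neg.neg = φ := funext heven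
    rw [e, neg_one_smul] at h
    exact (hD1 t).unique h
  have h := ((hD2 (-x)).scomp x (hasDerivAt_neg x)).neg
  have e : -(φ' ∘ Neg.neg) = φ' := funext fun t => (hodd t).symm
  rw [e, neg_one_smul, neg_neg] at h
  exact h.unique (hD2 x)

/-- A function supported in `[ε / δ, ε]` and dominated by `2 / (z log δ)` is bounded by
`2 δ / (ε log δ)` on the positive half-line. -/
lemma le_of_support_subset_of_le_div {δ ε : ℝ} {ψ : ℝ → ℝ} (hδ : 1 < δ) (hε : 0 < ε)
    (hψsupp : Function.support ψ ⊆ Set.Icc (ε / δ) ε)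
    (hψbd : ∀ z > 0, ψ z ≤ 2 / (z * Real.log δ)) {z : ℝ} (hz : 0 < z) :
    ψ z ≤ 2 * δ / (ε * Real.log δ) := by
  have hlog := Real.log_pos hδ
  have hδ0 : 0 < δ := by linarith
  by_cases h : ψ z = 0
  · rw [h]
    positivity
  · have hle : ε / δ ≤ z := (hψsupp h).1
    calc ψ z ≤ 2 / (z * Real.log δ) := hψbd z hz
      _ ≤ 2 / (ε / δ * Real.log δ) := by gcongr
      _ = 2 * δ / (ε * Real.log δ) := by field_simp

theorem statement10 (δ ε : ℝ) (hδ : 1 < δ) (hε : ε ∈ Set.Ioo (0:ℝ) 1)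
    (ψ : ℝ → ℝ) (hψc : Continuous ψ) (hψ0 : ∀ z, 0 ≤ ψ z)
    (hψsupp : Function.support ψ ⊆ Set.Icc (ε / δ) ε)
    (hψint : (∫ z in (ε / δ)..ε, ψ z) = 1)
    (hψbd : ∀ z > 0, ψ z ≤ 2 / (z * Real.log δ))
    (φ φ' φ'' : ℝ → ℝ)
    (hφ : ∀ x, φ x = ∫ y in (0:ℝ)..|x|, ∫ z in (0:ℝ)..y, ψ z)
    (hD1 : ∀ x, HasDerivAt φ (φ' x) x)
    (hD2 : ∀ x, HasDerivAt φ' (φ'' x) x)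
    (hD2c : Continuous φ'') :
    ∀ x x' y : ℝ, ∀ z > 0,
      |φ (y + x * z) - φ (y + x' * z) - (x - x') * z * φ' y| ≤
        (|x - x'| ^ 2 + |x'| * |x - x'|) * z ^ 2 * (2 * δ / (ε * Real.log δ)) := by
  intro x x' y z hz
  set M := 2 * δ / (ε * Real.log δ) with hMdef
  have hM : 0 ≤ M := by
    have := Real.log_pos hδ
    have := hε.1
    positivity
  have hpos : ∀ t > 0, |φ'' t| ≤ M := fun t ht => by
    rw [second_deriv_double_primitive_abs hψc hφ hD1 hD2 ht, abs_of_nonneg (hψ0 t)]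
    exact le_of_support_subset_of_le_div hδ hε.1 hψsupp hψbd ht
  have heven : ∀ t, φ (-t) = φ t := fun t => by rw [hφ, hφ, abs_neg]
  have hne : ∀ t ∈ ({0}ᶜ : Set ℝ), |φ'' t| ≤ M := fun t ht => by
    rcases lt_or_gt_of_ne ht with h | h
    · rw [← second_deriv_neg_of_even heven hD1 hD2]
      exact hpos _ (neg_pos.2 h)
    · exact hpos t h
  have hbound : ∀ t, |φ'' t| ≤ M := fun t =>
    (isClosed_le hD2c.abs continuous_const).closure_subset_iff.2 hne (dense_compl_singleton 0 t)
  have hlip : ∀ a b, |φ' a - φ' b| ≤ M * |a - b| := fun a b =>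
    convex_univ.norm_image_sub_le_of_norm_hasDerivWithin_le
      (fun t _ => (hD2 t).hasDerivWithinAt) (fun t _ => hbound t) (mem_univ b) (mem_univ a)
  have h := abs_sub_sub_mul_deriv_le hD1 hM hlip (y + x' * z) (y + x * z) y
  have e₁ : y + x * z - (y + x' * z) = (x - x') * z := by ring
  have e₂ : y + x' * z - y = x' * z := by ring
  rw [e₁, e₂, abs_mul, abs_mul, abs_of_pos hz] at h
  exact h.trans_eq (by ring)
end

section
/- Let b = b₁ + b₂, where b₁ : ℝ → ℝ is Lipschitz continuous with Lipschitz constant K₁ and b₂ : ℝ → ℝ is non-increasing. Then for all x, y ∈ ℝ with x ≠ y, φ'(x − y)·(b(x) − b(y)) ≤ K₁·|x − y|. -/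
open MeasureTheory Filter Set

/-- Over any `(0, u]`, a nonnegative continuous function supported in `[a, c]` integrates to at most
its integral over `[a, c]`. -/
theorem integral_le_integral_of_support_subset_Icc {ψ : ℝ → ℝ} {a c u : ℝ} (hac : a ≤ c)
    (hu : 0 ≤ u) (hψc : Continuous ψ) (hψ0 : ∀ z, 0 ≤ ψ z)
    (hψsupp : Function.support ψ ⊆ Set.Icc a c) :
    (∫ z in (0:ℝ)..u, ψ z) ≤ ∫ z in a..c, ψ z := by
  have hint : Integrable ψ :=
    (integrableOn_iff_integrable_of_support_subset hψsupp).1 hψc.continuousOn.integrableOn_Icc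
  rw [intervalIntegral.integral_of_le hu, intervalIntegral.integral_of_le hac,
    ← integral_Icc_eq_integral_Ioc (x := a), setIntegral_eq_integral_of_forall_compl_eq_zero
      (s := Set.Icc a c) fun x hx => by_contra fun h => hx (hψsupp h)]
  exact setIntegral_le_integral hint (Eventually.of_forall hψ0)

/-- The derivative away from the origin of the even function `x ↦ ∫₀^{|x|} g`. -/
theorem hasDerivAt_integral_abs {g : ℝ → ℝ} (hg : Continuous g) {x : ℝ} (hx : x ≠ 0) :
    HasDerivAt (fun t => ∫ y in (0:ℝ)..|t|, g y) (g |x| * SignType.sign x) x :=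
  (hg.integral_hasStrictDerivAt 0 |x|).hasDerivAt.comp x (hasDerivAt_abs hx)

theorem statement17 (δ ε : ℝ) (hδ : 1 < δ) (hε : ε ∈ Set.Ioo (0:ℝ) 1)
    (ψ : ℝ → ℝ) (hψc : Continuous ψ) (hψ0 : ∀ z, 0 ≤ ψ z)
    (hψsupp : Function.support ψ ⊆ Set.Icc (ε / δ) ε)
    (hψint : (∫ z in (ε / δ)..ε, ψ z) = 1)
    (hψbd : ∀ z > 0, ψ z ≤ 2 / (z * Real.log δ))
    (φ φ' φ'' : ℝ → ℝ)
    (hφ : ∀ x, φ x = ∫ y in (0:ℝ)..|x|, ∫ z in (0:ℝ)..y, ψ z)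
    (hD1 : ∀ x, HasDerivAt φ (φ' x) x)
    (hD2 : ∀ x, HasDerivAt φ' (φ'' x) x)
    (hD2c : Continuous φ'')
    (b₁ b₂ : ℝ → ℝ) (K₁ : ℝ)
    (hb₁ : ∀ x y : ℝ, |b₁ x - b₁ y| ≤ K₁ * |x - y|)
    (hb₂ : Antitone b₂) :
    ∀ x y : ℝ, x ≠ y →
      φ' (x - y) * ((b₁ x + b₂ x) - (b₁ y + b₂ y)) ≤ K₁ * |x - y| := by
  intro x y hxy
  have hεδ : ε / δ ≤ ε := div_le_self hε.1.le hδ.le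
  have hφ_eq : φ = fun t => ∫ y in (0:ℝ)..|t|, ∫ z in (0:ℝ)..y, ψ z := funext hφ
  have hI : Continuous fun y => ∫ z in (0:ℝ)..y, ψ z :=
    intervalIntegral.continuous_primitive (fun _ _ => hψc.intervalIntegrable _ _) 0
  have hd := hD1 (x - y)
  rw [hφ_eq] at hd
  rw [hd.unique (hasDerivAt_integral_abs hI (sub_ne_zero.2 hxy))]
  have h0 : 0 ≤ ∫ z in (0:ℝ)..|x - y|, ψ z :=
    intervalIntegral.integral_nonneg (abs_nonneg _) fun z _ => hψ0 z
  have h1 : (∫ z in (0:ℝ)..|x - y|, ψ z) ≤ 1 :=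
    (integral_le_integral_of_support_subset_Icc hεδ (abs_nonneg _) hψc hψ0 hψsupp).trans_eq hψint
  have hb := hb₁ x y
  have hK : 0 ≤ K₁ * |x - y| := (abs_nonneg _).trans hb
  obtain ⟨hl, hr⟩ := abs_le.1 hb
  have key : SignType.sign (x - y) * ((b₁ x + b₂ x) - (b₁ y + b₂ y)) ≤ K₁ * |x - y| := by
    rcases hxy.lt_or_gt with h | h
    · rw [sign_neg (sub_neg.2 h)]
      have := hb₂ h.le
      simp only [SignType.coe_neg, SignType.coe_one]
      linarith
    · rw [sign_pos (sub_pos.2 h)]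
      have := hb₂ h.le
      simp only [SignType.coe_one]
      linarith
  rw [mul_assoc]
  exact (mul_le_mul_of_nonneg_left key h0).trans (mul_le_of_le_one_left hK h1)
end
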